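/- Let β_1 > 0 satisfy β_1 < β + σ/(b−1). Then for every a > 1 the series ∑_{q=0}^{∞} δ_{q+1}^{1/2} · λ_{q+1}^{β_1} · ∏_{i=1}^{q} ε_i converges. -/

import Mathlib

open Filter Topology

/-- `λ_q := ⌈a^(b^q)⌉`, as a real number. -/
noncomputable def lam (a b : ℝ) (q : ℕ) : ℝ := (⌈a ^ (b ^ q)⌉₊ : ℝ)

/-- `δ_q := λ_q^(-2β)`. -/
noncomputable def del (a b β : ℝ) (q : ℕ) : ℝ := lam a b q ^ (-(2 * β))

/-- `ε_q := λ_q^(-σ)`. -/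
noncomputable def eps (a b σ : ℝ) (q : ℕ) : ℝ := lam a b q ^ (-σ)

/-- `τ_q := δ_q^(-1/2) λ_q^(-1-3α)`. -/
noncomputable def tau (a b β α : ℝ) (q : ℕ) : ℝ :=
  del a b β q ^ (-(1/2 : ℝ)) * lam a b q ^ (-(1 + 3 * α))

/-- `ℓ_q := δ_{q+1}^(1/2) δ_q^(-1/2) λ_q^(-(1+σ/2+3α/2))`. -/
noncomputable def ell (a b β σ α : ℝ) (q : ℕ) : ℝ :=
  del a b β (q + 1) ^ ((1/2 : ℝ)) * del a b β q ^ (-(1/2 : ℝ)) *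
    lam a b q ^ (-(1 + σ/2 + 3 * α / 2))

lemma rpow_le_lam (a b : ℝ) (q : ℕ) : a ^ (b ^ q) ≤ lam a b q :=
  Nat.le_ceil _

lemma lam_le_two_mul_rpow {a b : ℝ} (ha : 1 < a) (hb : 0 < b) (q : ℕ) :
    lam a b q ≤ 2 * a ^ (b ^ q) := by
  have h1 : 1 ≤ a ^ (b ^ q) := Real.one_le_rpow ha.le (by positivity)
  have h2 : lam a b q < a ^ (b ^ q) + 1 := Nat.ceil_lt_add_one (by linarith)
  linarith

lemma lam_pos {a : ℝ} (ha : 0 < a) (b : ℝ) (q : ℕ) : 0 < lam a b q :=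
  (Real.rpow_pos_of_pos ha _).trans_le (rpow_le_lam a b q)

lemma lam_rpow_le {a b : ℝ} (ha : 1 < a) (hb : 0 < b) (c : ℝ) (q : ℕ) :
    lam a b q ^ c ≤ 2 ^ |c| * a ^ (c * b ^ q) := by
  have ha0 : 0 < a := one_pos.trans ha
  have hx : 0 < a ^ (b ^ q) := Real.rpow_pos_of_pos ha0 _
  rw [mul_comm c, Real.rpow_mul ha0.le]
  rcases le_total 0 c with hc | hc
  · rw [abs_of_nonneg hc, ← Real.mul_rpow zero_le_two hx.le]
    exact Real.rpow_le_rpow (lam_pos ha0 b q).le (lam_le_two_mul_rpow ha hb q) hc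
  · calc lam a b q ^ c ≤ (a ^ (b ^ q)) ^ c :=
          Real.rpow_le_rpow_of_nonpos hx (rpow_le_lam a b q) hc
      _ ≤ 2 ^ |c| * (a ^ (b ^ q)) ^ c :=
          le_mul_of_one_le_left (Real.rpow_nonneg hx.le _)
            (Real.one_le_rpow one_le_two (abs_nonneg c))

lemma prod_eps_le {a b σ : ℝ} (ha : 0 < a) (hb : b ≠ 1) (hσ : 0 ≤ σ) (q : ℕ) :
    ∏ i ∈ Finset.Icc 1 q, eps a b σ i ≤ a ^ (-σ * ((b ^ (q + 1) - b) / (b - 1))) := by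
  have hb' : b - 1 ≠ 0 := sub_ne_zero.mpr hb
  induction q with
  | zero => simp
  | succ q ih =>
    rw [Finset.prod_Icc_succ_top (by lia)]
    have h : eps a b σ (q + 1) ≤ a ^ (-σ * b ^ (q + 1)) := by
      rw [mul_comm, Real.rpow_mul ha.le]
      exact Real.rpow_le_rpow_of_nonpos (Real.rpow_pos_of_pos ha _)
        (rpow_le_lam a b _) (neg_nonpos.mpr hσ)
    calc _ ≤ a ^ (-σ * ((b ^ (q + 1) - b) / (b - 1))) * a ^ (-σ * b ^ (q + 1)) :=
          mul_le_mul ih h (Real.rpow_nonneg (lam_pos ha b _).le _) (Real.rpow_nonneg ha.le _)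
      _ = _ := by
          rw [← Real.rpow_add ha]
          congr 1
          field_simp
          ring

/-- if `0 < β₁ < β + σ/(b-1)`, then for every `a > 1` the series
`∑_q δ_{q+1}^{1/2} λ_{q+1}^{β₁} ∏_{i=1}^{q} ε_i` converges. -/
theorem stmt11 (β b σ α a : ℝ) (hβ : 0 < β) (hβ' : β < 1/3) (hb : 1 < b) (hσ : 0 < σ)
    (hα : 0 < α) (ha : 1 < a) (β1 : ℝ) (hβ1 : 0 < β1) (hβ1' : β1 < β + σ / (b - 1)) :
    Summable (fun q : ℕ =>
      del a b β (q + 1) ^ ((1:ℝ)/2) * lam a b (q + 1) ^ β1 *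
        ∏ i ∈ Finset.Icc 1 q, eps a b σ i) := by
  have ha0 : 0 < a := one_pos.trans ha
  have hb1 : 0 < b - 1 := sub_pos.mpr hb
  set κ : ℝ := σ / (b - 1) - (β1 - β) with hκ
  have hκ0 : 0 < κ := by linarith
  have hr : a ^ (-(κ * (b - 1))) < 1 :=
    Real.rpow_lt_one_of_one_lt_of_neg ha (neg_neg_of_pos (mul_pos hκ0 hb1))
  refine Summable.of_nonneg_of_le (fun q => ?_) (fun q => ?_)
    ((summable_geometric_of_lt_one (Real.rpow_nonneg ha0.le _) hr).mul_left
      (2 ^ |β1 - β| * a ^ (σ * b / (b - 1))))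
  · have hl := fun n => (lam_pos ha0 b n).le
    exact mul_nonneg (mul_nonneg (Real.rpow_nonneg (Real.rpow_nonneg (hl _) _) _)
      (Real.rpow_nonneg (hl _) _)) (Finset.prod_nonneg fun i _ => Real.rpow_nonneg (hl i) _)
  · have hbern : (q : ℝ) * (b - 1) ≤ b ^ (q + 1) := by
      have h := one_add_mul_sub_le_pow (show (-1 : ℝ) ≤ b by linarith) (q + 1)
      push_cast at h
      linarith
    have hδ : del a b β (q + 1) ^ ((1 : ℝ) / 2) * lam a b (q + 1) ^ β1
        = lam a b (q + 1) ^ (β1 - β) := by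
      rw [del, ← Real.rpow_mul (lam_pos ha0 b _).le, ← Real.rpow_add (lam_pos ha0 b _)]
      congr 1
      ring
    rw [hδ]
    calc _ ≤ (2 ^ |β1 - β| * a ^ ((β1 - β) * b ^ (q + 1))) *
            a ^ (-σ * ((b ^ (q + 1) - b) / (b - 1))) :=
          mul_le_mul (lam_rpow_le ha (by linarith) _ _) (prod_eps_le ha0 hb.ne' hσ.le q)
            (Finset.prod_nonneg fun i _ => Real.rpow_nonneg (lam_pos ha0 b i).le _)
            (by positivity)
      _ = 2 ^ |β1 - β| * a ^ (σ * b / (b - 1)) * a ^ (-κ * b ^ (q + 1)) := by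
          rw [mul_assoc, mul_assoc, ← Real.rpow_add ha0, ← Real.rpow_add ha0]
          congr 2
          rw [hκ]
          field_simp
          ring
      _ ≤ _ := by
          rw [← Real.rpow_mul_natCast ha0.le]
          refine mul_le_mul_of_nonneg_left
            (Real.rpow_le_rpow_of_exponent_le ha.le ?_) (by positivity)
          linarith [mul_le_mul_of_nonneg_left hbern hκ0.le]
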